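/- Let p and q be distinct odd primes, n = pq, φ = (p−1)(q−1), and let r be a positive integer with r ∣ p−1, gcd(r, (p−1)/r) = 1 and gcd(r, q−1) = 1. Let y be an integer coprime to n, g a primitive root modulo p, and α an integer with y ≡ g^α (mod p), and set u = gcd(α, r). If 1 < u < r, then y satisfies Benaloh's original key-generation condition y^{φ/r} ≢ 1 (mod n) and yet decryption is ambiguous: there exist integers m₁, m₂ with m₁ ≢ m₂ (mod r) and integers u₁, u₂ coprime to n such that y^{m₁}·u₁^r ≡ y^{m₂}·u₂^r (mod n). -/

import Mathlib

theorem Int.ModEq.isCoprime {a b n : ℤ} (h : a ≡ b [ZMOD n]) (ha : IsCoprime a n) :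
    IsCoprime b n := by
  obtain ⟨c, hc⟩ := h.dvd
  obtain rfl : b = a + n * c := by linarith
  exact ha.add_mul_left_left c

theorem Int.exists_modEq_and_modEq {m n : ℤ} (h : IsCoprime m n) (a b : ℤ) :
    ∃ c : ℤ, c ≡ a [ZMOD m] ∧ c ≡ b [ZMOD n] := by
  obtain ⟨s, t, hst⟩ := h
  refine ⟨a * (t * n) + b * (s * m), ?_, ?_⟩
  · refine (Int.modEq_iff_dvd.2 ⟨s * (a - b), ?_⟩)
    linear_combination (-a) * hst
  · refine (Int.modEq_iff_dvd.2 ⟨t * (b - a), ?_⟩)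
    linear_combination (-b) * hst

/-- If `r` is coprime to `q - 1`, every integer prime to `q` is an `r`-th power modulo `q`. -/
theorem Int.exists_pow_modEq_of_coprime {q r : ℕ} (hq : q.Prime) (hr : r.Coprime (q - 1))
    {a : ℤ} (ha : IsCoprime a (q : ℤ)) : ∃ w : ℤ, w ^ r ≡ a [ZMOD (q : ℤ)] := by
  have : Fact q.Prime := ⟨hq⟩
  have hcard : (Nat.card (ZMod q)ˣ).Coprime r := by
    rw [Nat.card_eq_fintype_card, ZMod.card_units]
    exact hr.symm
  obtain ⟨v, hv⟩ := (powCoprime hcard).surjective (ZMod.unitOfIsCoprime a ha)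
  obtain ⟨w, hw⟩ := ZMod.intCast_surjective (v : (ZMod q))
  refine ⟨w, (ZMod.intCast_eq_intCast_iff _ _ _).1 ?_⟩
  have h := congrArg (Units.val) hv
  simpa [hw] using h

/-- The exponents killing a primitive root modulo a prime `p` are multiples of `p - 1`. -/
theorem Int.sub_one_dvd_of_primitiveRoot_pow_modEq_one {p : ℕ} (hp : p.Prime) {g : ℤ}
    (hgp : IsCoprime g (p : ℤ))
    (hg : ∀ z : ℤ, IsCoprime z (p : ℤ) → ∃ k : ℕ, z ≡ g ^ k [ZMOD (p : ℤ)])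
    {k : ℕ} (hk : g ^ k ≡ 1 [ZMOD (p : ℤ)]) : p - 1 ∣ k := by
  have : Fact p.Prime := ⟨hp⟩
  set G := ZMod.unitOfIsCoprime g hgp with hG
  have hGval : (G : ZMod p) = g := by simp [hG]
  have horder : orderOf G = p - 1 := by
    rw [← ZMod.card_units p, ← Nat.card_eq_fintype_card]
    refine orderOf_eq_card_of_forall_mem_zpowers fun v => ?_
    obtain ⟨z, hz⟩ := ZMod.intCast_surjective (v : (ZMod p))
    have hzp : IsCoprime z (p : ℤ) :=
      ((ZMod.coe_int_isUnit_iff_isCoprime z p).1 (hz ▸ v.isUnit)).symm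
    obtain ⟨j, hj⟩ := hg z hzp
    refine Subgroup.mem_zpowers_iff.2 ⟨j, Units.ext ?_⟩
    have h := (ZMod.intCast_eq_intCast_iff _ _ _).2 hj
    simp [hGval, ← hz, h]
  rw [← horder]
  refine orderOf_dvd_of_pow_eq_one (Units.ext ?_)
  have h := (ZMod.intCast_eq_intCast_iff _ _ _).2 hk
  simpa [hGval] using h

theorem benaloh_undetected_faulty (p q n : ℕ) (hp : p.Prime) (hq : q.Prime)
    (hpodd : Odd p) (hqodd : Odd q) (hpq : p ≠ q)
    (hn : n = p * q) (φ : ℕ) (hφ : φ = (p - 1) * (q - 1)) (r : ℕ) (hr : 0 < r) (hrp : r ∣ p - 1)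
    (hr1 : Nat.Coprime r ((p - 1) / r)) (hr2 : Nat.Coprime r (q - 1)) (y : ℤ) (hy : IsCoprime y (n : ℤ))
    (g : ℤ)
    (hg : ∀ z : ℤ, IsCoprime z (p : ℤ) → ∃ k : ℕ, z ≡ g ^ k [ZMOD (p : ℤ)])
    (α : ℕ) (hα : y ≡ g ^ α [ZMOD (p : ℤ)])
    (hu1 : 1 < Nat.gcd α r) (hu2 : Nat.gcd α r < r) :
    ¬ (y ^ (φ / r) ≡ 1 [ZMOD (n : ℤ)]) ∧
    ∃ (m₁ m₂ : ℕ) (u₁ u₂ : ℤ), ¬ (m₁ ≡ m₂ [MOD r]) ∧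
      IsCoprime u₁ (n : ℤ) ∧ IsCoprime u₂ (n : ℤ) ∧
      y ^ m₁ * u₁ ^ r ≡ y ^ m₂ * u₂ ^ r [ZMOD (n : ℤ)] := by
  have hnZ : (n : ℤ) = p * q := by exact_mod_cast hn
  have hyp : IsCoprime y (p : ℤ) := (hnZ ▸ hy).of_mul_right_left
  have hyq : IsCoprime y (q : ℤ) := (hnZ ▸ hy).of_mul_right_right
  have hpqZ : IsCoprime (p : ℤ) (q : ℤ) :=
    Nat.isCoprime_iff_coprime.2 ((Nat.coprime_primes hp hq).2 hpq)
  have hα0 : 0 < α := by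
    rcases Nat.eq_zero_or_pos α with rfl | h
    · simp at hu2
    · exact h
  have hgp : IsCoprime g (p : ℤ) := (IsCoprime.pow_left_iff hα0).1 (hα.isCoprime hyp)
  constructor
  · intro h
    obtain ⟨s, hs⟩ := hrp
    have hs0 : 0 < s := by
      have := hp.two_le
      exact Nat.pos_of_ne_zero (by rintro rfl; omega)
    have hφr : φ / r = s * (q - 1) := by
      rw [hφ, hs, mul_assoc, Nat.mul_div_cancel_left _ hr]
    have hgk : g ^ (α * (φ / r)) ≡ 1 [ZMOD (p : ℤ)] := by
      rw [pow_mul]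
      exact (hα.pow _).symm.trans (h.of_dvd ⟨_, hnZ⟩)
    have hdvd := Int.sub_one_dvd_of_primitiveRoot_pow_modEq_one hp hgp hg hgk
    rw [hs, hφr, show α * (s * (q - 1)) = (α * (q - 1)) * s by ring] at hdvd
    have hrα : r ∣ α := hr2.dvd_of_dvd_mul_right (Nat.dvd_of_mul_dvd_mul_right hs0 hdvd)
    exact hu2.ne (Nat.gcd_eq_right hrα)
  · set u := Nat.gcd α r with hu
    obtain ⟨a, ha⟩ : u ∣ α := Nat.gcd_dvd_left α r
    obtain ⟨t, ht⟩ : u ∣ r := Nat.gcd_dvd_right α r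
    obtain ⟨v, hv⟩ := Int.exists_pow_modEq_of_coprime hq hr2 (hyq.pow_left (m := t))
    obtain ⟨w, hwp, hwq⟩ := Int.exists_modEq_and_modEq hpqZ (g ^ a) v
    have hw : y ^ t ≡ w ^ r [ZMOD (n : ℤ)] := by
      rw [hnZ, ← Int.modEq_and_modEq_iff_modEq_mul (by simpa [Nat.coprime_primes hp hq] using hpq)]
      refine ⟨(hα.pow t).trans ?_, ((hwq.pow r).trans hv).symm⟩
      rw [← pow_mul, show α * t = a * r by rw [ht, ha]; ring, pow_mul]
      exact (hwp.pow r).symm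
    refine ⟨t, 0, 1, w, fun h => ?_, isCoprime_one_left, ?_, by simpa using hw⟩
    · have ht0 : 0 < t := Nat.pos_of_ne_zero (by rintro rfl; omega)
      have := Nat.le_of_dvd ht0 ((Nat.modEq_zero_iff_dvd).1 h)
      nlinarith
    · exact (IsCoprime.pow_left_iff hr).1 (hw.isCoprime hy.pow_left)
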